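/- Let n ∈ ℕ satisfy W_n = { ⟨m, ⌜φ⌝⟩ : φ an 𝓛-formula with free variables ⊆ {x} and Σ(n) ⊨ φ(x|m̄) }. Then for every 𝓛-formula φ with free variables ⊆ {x}, the structure M_{Σ(n)} satisfies ∀x(Kφ ↔ ⟨x, ⌜φ⌝⟩ ∈ W_n̄). -/

import Mathlib

/-!
Formalization of the framework of "A machine that knows its own code" (S. Alexander).

The language 𝓛 is the language of Peano arithmetic (constant `0`, unary successor `S`,
binary `+` and `·`) extended by a unary modal operator `K`.
-/

/-- Terms of the language 𝓛 of Peano arithmetic (variables are indexed by `ℕ`). -/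
inductive LTerm : Type
  | var : ℕ → LTerm
  | zero : LTerm
  | succ : LTerm → LTerm
  | add : LTerm → LTerm → LTerm
  | mul : LTerm → LTerm → LTerm
  deriving DecidableEq

/-- Formulas of 𝓛: atomic equalities, falsum, implication, universal quantification,
and the modal operator `K`.  Other connectives and `∃` are defined below. -/
inductive LFormula : Type
  | eq : LTerm → LTerm → LFormula
  | falsum : LFormula
  | imp : LFormula → LFormula → LFormula
  | all : ℕ → LFormula → LFormula
  | K : LFormula → LFormula
  deriving DecidableEq

namespace LTerm

/-- Variables occurring in a term. -/
def fv : LTerm → Finset ℕ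
  | var n => {n}
  | zero => ∅
  | succ t => t.fv
  | add t u => t.fv ∪ u.fv
  | mul t u => t.fv ∪ u.fv

/-- Simultaneous substitution of terms for variables in a term. -/
def subst (s : ℕ → LTerm) : LTerm → LTerm
  | var n => s n
  | zero => zero
  | succ t => succ (t.subst s)
  | add t u => add (t.subst s) (u.subst s)
  | mul t u => mul (t.subst s) (u.subst s)

end LTerm

/-- The numeral `n̄` for a natural number `n`. -/
def numeral : ℕ → LTerm
  | 0 => LTerm.zero
  | n + 1 => LTerm.succ (numeral n)

namespace LFormula

/-- The free variables of a formula (the free variables of `K φ` are those of `φ`). -/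
def fv : LFormula → Finset ℕ
  | eq t u => t.fv ∪ u.fv
  | falsum => ∅
  | imp a b => a.fv ∪ b.fv
  | all x a => a.fv.erase x
  | K a => a.fv

/-- Simultaneous substitution of terms for the *free* variables of a formula
(bound variables are left untouched; the substitution is not capture-avoiding). -/
def subst (s : ℕ → LTerm) : LFormula → LFormula
  | eq t u => eq (t.subst s) (u.subst s)
  | falsum => falsum
  | imp a b => imp (a.subst s) (b.subst s)
  | all x a => all x (a.subst fun z => if z = x then LTerm.var x else s z)
  | K a => K (a.subst s)

end LFormula

/-- `subst1 x t φ` is `φ(x|t)`, the result of substituting the term `t` for the free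
occurrences of the variable `x` in `φ`. -/
def subst1 (x : ℕ) (t : LTerm) (φ : LFormula) : LFormula :=
  φ.subst fun z => if z = x then t else LTerm.var z

/-- `instNum s φ` is `φ^s`: the sentence obtained from `φ` by replacing each free
variable `x` of `φ` by the numeral for `s x`. -/
def instNum (s : ℕ → ℕ) (φ : LFormula) : LFormula :=
  φ.subst fun z => numeral (s z)

/-- `SubstitutableVar y x φ`: the variable `y` is substitutable for the variable `x`
in `φ` (no free occurrence of `x` lies within the scope of a quantifier binding `y`). -/
def SubstitutableVar (y x : ℕ) : LFormula → Prop
  | .eq _ _ => True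
  | .falsum => True
  | .imp a b => SubstitutableVar y x a ∧ SubstitutableVar y x b
  | .all z a => x ∉ (LFormula.all z a).fv ∨ (y ≠ z ∧ SubstitutableVar y x a)
  | .K a => SubstitutableVar y x a

/-- Correspondence of variables relative to a list of pairs of bound variables. -/
def VarCorr : List (ℕ × ℕ) → ℕ → ℕ → Prop
  | [], x, y => x = y
  | (a, b) :: Γ, x, y => (x = a ∧ y = b) ∨ (x ≠ a ∧ y ≠ b ∧ VarCorr Γ x y)

/-- Alpha-correspondence of terms relative to a list of pairs of bound variables. -/
def TermAlpha (Γ : List (ℕ × ℕ)) : LTerm → LTerm → Prop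
  | .var x, .var y => VarCorr Γ x y
  | .zero, .zero => True
  | .succ t, .succ u => TermAlpha Γ t u
  | .add t₁ t₂, .add u₁ u₂ => TermAlpha Γ t₁ u₁ ∧ TermAlpha Γ t₂ u₂
  | .mul t₁ t₂, .mul u₁ u₂ => TermAlpha Γ t₁ u₁ ∧ TermAlpha Γ t₂ u₂
  | _, _ => False

/-- Alpha-correspondence of formulas relative to a list of pairs of bound variables. -/
def FormulaAlpha : List (ℕ × ℕ) → LFormula → LFormula → Prop
  | Γ, .eq t₁ t₂, .eq u₁ u₂ => TermAlpha Γ t₁ u₁ ∧ TermAlpha Γ t₂ u₂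
  | _, .falsum, .falsum => True
  | Γ, .imp a₁ a₂, .imp b₁ b₂ => FormulaAlpha Γ a₁ b₁ ∧ FormulaAlpha Γ a₂ b₂
  | Γ, .all x a, .all y b => FormulaAlpha ((x, y) :: Γ) a b
  | Γ, .K a, .K b => FormulaAlpha Γ a b
  | _, _, _ => False

/-- `ψ` is an alphabetic variant of `φ`: `ψ` is obtained from `φ` by renaming bound
variables so as to respect the binding of the quantifiers. -/
def AlphaVariant (φ ψ : LFormula) : Prop := FormulaAlpha [] φ ψ

/-- Negation, defined from `→` and `⊥`. -/
def notF (φ : LFormula) : LFormula := LFormula.imp φ LFormula.falsum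

/-- Conjunction (defined connective). -/
def andF (φ ψ : LFormula) : LFormula := notF (LFormula.imp φ (notF ψ))

/-- Biconditional (defined connective). -/
def iffF (φ ψ : LFormula) : LFormula := andF (LFormula.imp φ ψ) (LFormula.imp ψ φ)

/-- Existential quantification (defined). -/
def exF (x : ℕ) (φ : LFormula) : LFormula := notF (LFormula.all x (notF φ))

/-- A canonical universal closure of a formula. -/
def uclose (φ : LFormula) : LFormula :=
  (φ.fv.sort (· ≤ ·)).foldr LFormula.all φ

/-- An 𝓛-structure: a first-order structure for the first-order part of 𝓛, together
with a truth assignment `satK s φ` for the purely modal formulas `K φ` at each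
assignment `s` into the universe (the three required constraints are singled out
in `IsLStructure` below). -/
structure LStructure where
  U : Type
  nonempty : Nonempty U
  zero : U
  succ : U → U
  add : U → U → U
  mul : U → U → U
  satK : (ℕ → U) → LFormula → Prop

namespace LStructure

/-- Value of a term under an assignment. -/
def evalT (M : LStructure) (s : ℕ → M.U) : LTerm → M.U
  | .var n => s n
  | .zero => M.zero
  | .succ t => M.succ (M.evalT s t)
  | .add t u => M.add (M.evalT s t) (M.evalT s u)
  | .mul t u => M.mul (M.evalT s t) (M.evalT s u)

/-- Satisfaction `M ⊨ φ[s]`, defined by the usual induction on formula complexity,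
with `M ⊨ (K φ)[s]` given by the structure's truth assignment `satK`. -/
def Sat (M : LStructure) : (ℕ → M.U) → LFormula → Prop
  | s, .eq t u => M.evalT s t = M.evalT s u
  | _, .falsum => False
  | s, .imp a b => M.Sat s a → M.Sat s b
  | s, .all x a => ∀ u : M.U, M.Sat (Function.update s x u) a
  | s, .K a => M.satK s a

/-- `M ⊨ φ`: `M ⊨ φ[s]` for every assignment `s`. -/
def Models (M : LStructure) (φ : LFormula) : Prop := ∀ s : ℕ → M.U, M.Sat s φ

end LStructure

/-- The three constraints making an `LStructure` a genuine 𝓛-structure of the base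
logic: (a) `satK s φ` depends only on the values of `s` on the free variables of `φ`;
(b) invariance under alphabetic variants; (c) weak substitution. -/
def IsLStructure (M : LStructure) : Prop :=
  (∀ (φ : LFormula) (s t : ℕ → M.U), (∀ x ∈ φ.fv, s x = t x) →
      (M.satK s φ ↔ M.satK t φ)) ∧
  (∀ (φ ψ : LFormula) (s : ℕ → M.U), AlphaVariant φ ψ →
      (M.satK s φ ↔ M.satK s ψ)) ∧
  (∀ (φ : LFormula) (x y : ℕ) (s : ℕ → M.U), SubstitutableVar y x φ →
      (M.satK s (subst1 x (LTerm.var y) φ) ↔ M.satK (Function.update s x (s y)) φ))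

/-- `Σ ⊨ φ`: every 𝓛-structure satisfying every member of `Σ` satisfies `φ`. -/
def Consequence (T : Set LFormula) (φ : LFormula) : Prop :=
  ∀ M : LStructure, IsLStructure M → (∀ σ ∈ T, M.Models σ) → M.Models φ

/-- `φ` is valid: `∅ ⊨ φ`, i.e. `φ` holds in every 𝓛-structure under every assignment. -/
def Valid (φ : LFormula) : Prop := Consequence ∅ φ

/-- The structure `M_Σ`: universe `ℕ`, standard interpretations of the symbols of
Peano arithmetic, and `M_Σ ⊨ (K φ)[s]` iff `Σ ⊨ φ^s`. -/
def MSigma (T : Set LFormula) : LStructure where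
  U := ℕ
  nonempty := ⟨0⟩
  zero := 0
  succ := Nat.succ
  add := (· + ·)
  mul := (· * ·)
  satK := fun s φ => Consequence T (instNum s φ)

/-- Instances of the schema `E1`: the universal closure of `K φ` for valid `φ`. -/
def E1set : Set LFormula :=
  {χ | ∃ φ : LFormula, Valid φ ∧ χ = uclose (LFormula.K φ)}

/-- Instances of the schema `E2`: the universal closure of `K(φ → ψ) → K φ → K ψ`. -/
def E2set : Set LFormula :=
  {χ | ∃ φ ψ : LFormula,
    χ = uclose (LFormula.imp (LFormula.K (LFormula.imp φ ψ))
      (LFormula.imp (LFormula.K φ) (LFormula.K ψ)))}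

/-- Instances of the schema `E3` (factivity): the universal closure of `K φ → φ`. -/
def E3set : Set LFormula :=
  {χ | ∃ φ : LFormula, χ = uclose (LFormula.imp (LFormula.K φ) φ)}

/-- Instances of the schema `E4`: the universal closure of `K φ → K K φ`. -/
def E4set : Set LFormula :=
  {χ | ∃ φ : LFormula, χ = uclose (LFormula.imp (LFormula.K φ) (LFormula.K (LFormula.K φ)))}

/-- The axioms of Peano arithmetic for 𝓛: the six usual axioms for successor,
addition and multiplication, and the induction schema extended to all 𝓛-formulas. -/
inductive PAax : LFormula → Prop
  | succ_ne_zero : PAax (.all 0 (notF (.eq (.succ (.var 0)) .zero)))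
  | succ_inj : PAax (.all 0 (.all 1 (.imp (.eq (.succ (.var 0)) (.succ (.var 1)))
      (.eq (.var 0) (.var 1)))))
  | add_zero : PAax (.all 0 (.eq (.add (.var 0) .zero) (.var 0)))
  | add_succ : PAax (.all 0 (.all 1 (.eq (.add (.var 0) (.succ (.var 1)))
      (.succ (.add (.var 0) (.var 1))))))
  | mul_zero : PAax (.all 0 (.eq (.mul (.var 0) .zero) .zero))
  | mul_succ : PAax (.all 0 (.all 1 (.eq (.mul (.var 0) (.succ (.var 1)))
      (.add (.mul (.var 0) (.var 1)) (.var 0)))))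
  | ind (φ : LFormula) (x : ℕ) :
      PAax (uclose (.imp (subst1 x .zero φ)
        (.imp (.all x (.imp φ (subst1 x (.succ (.var x)) φ))) (.all x φ))))

/-- The set of axioms of Peano arithmetic for 𝓛. -/
def PAset : Set LFormula := {φ | PAax φ}

/-- `W e`: the `e`-th recursively enumerable subset of `ℕ` (the domain of the `e`-th
partial computable function). -/
def W (e : ℕ) : Set ℕ :=
  {m | ((Denumerable.ofNat Nat.Partrec.Code e).eval m).Dom}

namespace LTerm

/-- A canonical Gödel numbering of terms. -/
def gnum : LTerm → ℕ
  | var n => Nat.pair 0 n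
  | zero => Nat.pair 1 0
  | succ t => Nat.pair 2 t.gnum
  | add t u => Nat.pair 3 (Nat.pair t.gnum u.gnum)
  | mul t u => Nat.pair 4 (Nat.pair t.gnum u.gnum)

end LTerm

namespace LFormula

/-- A canonical Gödel numbering `⌜φ⌝` of formulas. -/
def gnum : LFormula → ℕ
  | eq t u => Nat.pair 0 (Nat.pair t.gnum u.gnum)
  | falsum => Nat.pair 1 0
  | imp a b => Nat.pair 2 (Nat.pair a.gnum b.gnum)
  | all x a => Nat.pair 3 (Nat.pair x a.gnum)
  | K a => Nat.pair 4 a.gnum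

end LFormula

/-- The designated variable `x`. -/
def vx : ℕ := 0
/-- The designated variable `y` (second pairing argument). -/
def vy : ℕ := 1
/-- The designated variable `e` (r.e. index). -/
def ve : ℕ := 2

/-- A formula is `K`-free (purely first-order) if the operator `K` does not occur in it. -/
def KFree : LFormula → Prop
  | .eq _ _ => True
  | .falsum => True
  | .imp a b => KFree a ∧ KFree b
  | .all _ a => KFree a
  | .K _ => False

/-- The standard structure: universe `ℕ` with the standard interpretations of the
symbols of Peano arithmetic (the modal component is irrelevant for `K`-free formulas). -/
def StdModel : LStructure where
  U := ℕ
  nonempty := ⟨0⟩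
  zero := 0
  succ := Nat.succ
  add := (· + ·)
  mul := (· * ·)
  satK := fun _ _ => False

/-- `pwNum pw a b k`: the result of substituting the numerals `ā`, `b̄`, `k̄` for the
designated variables `x`, `y`, `e` in the formula `pw` (read: `⟨ā, b̄⟩ ∈ W_k̄`). -/
def pwNum (pw : LFormula) (a b k : ℕ) : LFormula :=
  instNum (fun z => if z = vx then a else if z = vy then b else k) pw

/-- `wNum w a k`: the result of substituting the numerals `ā`, `k̄` for the designated
variables `x`, `e` in the formula `w` (read: `ā ∈ W_k̄`). -/
def wNum (w : LFormula) (a k : ℕ) : LFormula :=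
  instNum (fun z => if z = vx then a else k) w

/-- Line 3 of the definition of `Σ(n)`: the sentence
`∀x (K φ ↔ ⟨x, ⌜φ⌝⟩ ∈ W_n̄)`, where `pw` is the formula (with designated free
variables `x`, `y`, `e`) expressing `⟨x, y⟩ ∈ W_e`. -/
def line3 (pw : LFormula) (n : ℕ) (φ : LFormula) : LFormula :=
  LFormula.all vx (iffF (LFormula.K φ)
    (subst1 ve (numeral n) (subst1 vy (numeral φ.gnum) pw)))

/-- Membership in the axiom set `Σ(n)` (relative to the formula `pw` expressing
`⟨x, y⟩ ∈ W_e`): (1) instances of `E1`, `E2`, `E4`; (2) the axioms of Peano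
arithmetic for 𝓛; (3) `∀x (K φ ↔ ⟨x, ⌜φ⌝⟩ ∈ W_n̄)` for `φ` with free variables
⊆ {x}; (4) assigned validity `φ^s` for valid `φ`; (5) `K φ` for `φ` an instance of
lines 1–4 or, recursively, of line 5. -/
inductive SigmaAx (pw : LFormula) (n : ℕ) : LFormula → Prop
  | e1 {χ : LFormula} (h : χ ∈ E1set) : SigmaAx pw n χ
  | e2 {χ : LFormula} (h : χ ∈ E2set) : SigmaAx pw n χ
  | e4 {χ : LFormula} (h : χ ∈ E4set) : SigmaAx pw n χ
  | pa {χ : LFormula} (h : PAax χ) : SigmaAx pw n χ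
  | code (φ : LFormula) (h : φ.fv ⊆ {vx}) : SigmaAx pw n (line3 pw n φ)
  | av (φ : LFormula) (s : ℕ → ℕ) (h : Valid φ) : SigmaAx pw n (instNum s φ)
  | k {φ : LFormula} (h : SigmaAx pw n φ) : SigmaAx pw n (LFormula.K φ)

/-- The axiom set `Σ(n)` (relative to `pw`). -/
def SigmaN (pw : LFormula) (n : ℕ) : Set LFormula := {φ | SigmaAx pw n φ}

/-- The set `{ ⟨m, ⌜φ⌝⟩ : φ an 𝓛-formula with free variables ⊆ {x} and
Σ(n) ⊨ φ(x|m̄) }`. -/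
def goalSet (pw : LFormula) (n : ℕ) : Set ℕ :=
  {p | ∃ (m : ℕ) (φ : LFormula), p = Nat.pair m φ.gnum ∧ φ.fv ⊆ {vx} ∧
    Consequence (SigmaN pw n) (subst1 vx (numeral m) φ)}

theorem LTerm.gnum_injective : Function.Injective LTerm.gnum := by
  intro t
  induction t with
  | var n => intro u h; cases u <;> simp_all [LTerm.gnum]
  | zero => intro u h; cases u <;> simp_all [LTerm.gnum]
  | succ t ih => intro u h; cases u <;> simp_all [LTerm.gnum]; exact ih rfl
  | add t₁ t₂ ih₁ ih₂ =>
    intro u h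
    cases u <;> simp_all [LTerm.gnum]
    exact ⟨ih₁ rfl, ih₂ rfl⟩
  | mul t₁ t₂ ih₁ ih₂ =>
    intro u h
    cases u <;> simp_all [LTerm.gnum]
    exact ⟨ih₁ rfl, ih₂ rfl⟩

theorem LFormula.gnum_injective : Function.Injective LFormula.gnum := by
  intro φ
  induction φ with
  | eq t u =>
    intro ψ h
    cases ψ <;> simp_all [LFormula.gnum]
    exact ⟨LTerm.gnum_injective h.1, LTerm.gnum_injective h.2⟩
  | falsum => intro ψ h; cases ψ <;> simp_all [LFormula.gnum]
  | imp a b iha ihb =>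
    intro ψ h
    cases ψ <;> simp_all [LFormula.gnum]
    exact ⟨iha rfl, ihb rfl⟩
  | all x a ih => intro ψ h; cases ψ <;> simp_all [LFormula.gnum]; exact ih rfl
  | K a ih => intro ψ h; cases ψ <;> simp_all [LFormula.gnum]; exact ih rfl

theorem LTerm.subst_congr {σ τ : ℕ → LTerm} (t : LTerm) (h : ∀ x ∈ t.fv, σ x = τ x) :
    t.subst σ = t.subst τ := by
  induction t <;> simp_all [LTerm.subst, LTerm.fv]

theorem LFormula.subst_congr (φ : LFormula) :
    ∀ {σ τ : ℕ → LTerm}, (∀ x ∈ φ.fv, σ x = τ x) → φ.subst σ = φ.subst τ := by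
  induction φ with
  | eq t u =>
    intro σ τ h
    simp only [LFormula.fv, Finset.mem_union] at h
    simp only [LFormula.subst]
    rw [t.subst_congr fun x hx => h x (.inl hx), u.subst_congr fun x hx => h x (.inr hx)]
  | falsum => intro σ τ h; rfl
  | imp a b iha ihb =>
    intro σ τ h
    simp only [LFormula.fv, Finset.mem_union] at h
    simp only [LFormula.subst]
    rw [iha fun x hx => h x (.inl hx), ihb fun x hx => h x (.inr hx)]
  | all y a ih =>
    intro σ τ h
    simp only [LFormula.fv, Finset.mem_erase] at h
    simp only [LFormula.subst]
    congr 1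
    refine ih fun x hx => ?_
    split_ifs with hxy
    · rfl
    · exact h x ⟨hxy, hx⟩
  | K a ih => intro σ τ h; simp only [LFormula.subst]; rw [ih h]

/-- A numeral instance of a formula whose only free variable is `x` is the substitution of a
single numeral for `x`. -/
theorem instNum_eq_subst1 {x : ℕ} {φ : LFormula} (hφ : φ.fv ⊆ {x}) (s : ℕ → ℕ) :
    instNum s φ = subst1 x (numeral (s x)) φ := by
  refine φ.subst_congr fun z hz => ?_
  obtain rfl : z = x := by simpa using hφ hz
  simp

theorem numeral_fv (n : ℕ) : (numeral n).fv = ∅ := by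
  induction n with
  | zero => rfl
  | succ n ih => exact ih

namespace LStructure

variable (M : LStructure)

theorem evalT_congr {s s' : ℕ → M.U} (t : LTerm) (h : ∀ x ∈ t.fv, s x = s' x) :
    M.evalT s t = M.evalT s' t := by
  induction t <;> simp_all [LStructure.evalT, LTerm.fv]

theorem evalT_subst (σ : ℕ → LTerm) (s : ℕ → M.U) (t : LTerm) :
    M.evalT s (t.subst σ) = M.evalT (fun z => M.evalT s (σ z)) t := by
  induction t <;> simp_all [LStructure.evalT, LTerm.subst]

theorem sat_congr_of_kFree (φ : LFormula) (hφ : KFree φ) :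
    ∀ {s s' : ℕ → M.U}, (∀ x ∈ φ.fv, s x = s' x) → (M.Sat s φ ↔ M.Sat s' φ) := by
  induction φ with
  | eq t u =>
    intro s s' h
    simp only [LFormula.fv, Finset.mem_union] at h
    simp only [LStructure.Sat]
    rw [M.evalT_congr t fun x hx => h x (.inl hx), M.evalT_congr u fun x hx => h x (.inr hx)]
  | falsum => intro s s' h; rfl
  | imp a b iha ihb =>
    intro s s' h
    simp only [LFormula.fv, Finset.mem_union] at h
    exact imp_congr (iha hφ.1 fun x hx => h x (.inl hx)) (ihb hφ.2 fun x hx => h x (.inr hx))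
  | all y a ih =>
    intro s s' h
    simp only [LFormula.fv, Finset.mem_erase] at h
    refine forall_congr' fun u => ih hφ fun x hx => ?_
    by_cases hxy : x = y
    · subst hxy; simp
    · simpa [hxy] using h x ⟨hxy, hx⟩
  | K a ih => exact hφ.elim

/-- The substitution lemma for `K`-free formulas, for substitutions that replace variables
by closed terms only. -/
theorem sat_subst_of_kFree (φ : LFormula) (hφ : KFree φ) :
    ∀ {σ : ℕ → LTerm}, (∀ z, σ z = .var z ∨ (σ z).fv = ∅) → ∀ s : ℕ → M.U,
      (M.Sat s (φ.subst σ) ↔ M.Sat (fun z => M.evalT s (σ z)) φ) := by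
  induction φ with
  | eq t u => intro σ hσ s; simp only [LFormula.subst, LStructure.Sat, evalT_subst]
  | falsum => intro σ hσ s; rfl
  | imp a b iha ihb => intro σ hσ s; exact imp_congr (iha hφ.1 hσ s) (ihb hφ.2 hσ s)
  | all y a ih =>
    intro σ hσ s
    refine forall_congr' fun u => ?_
    rw [ih hφ (fun z => by split_ifs with h <;> simp [h, hσ z])]
    refine M.sat_congr_of_kFree a hφ fun z _ => ?_
    by_cases hzy : z = y
    · subst hzy; simp [LStructure.evalT]
    · rcases hσ z with h | h
      · simp [hzy, h, LStructure.evalT]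
      · simp only [hzy, if_false, ne_eq, not_false_eq_true, Function.update_of_ne]
        exact M.evalT_congr _ fun x hx => by simp [h] at hx
  | K a ih => exact hφ.elim

end LStructure

theorem KFree.subst {φ : LFormula} (hφ : KFree φ) (σ : ℕ → LTerm) : KFree (φ.subst σ) := by
  induction φ generalizing σ with
  | eq t u => trivial
  | falsum => trivial
  | imp a b iha ihb => exact ⟨iha hφ.1 σ, ihb hφ.2 σ⟩
  | all y a ih => exact ih hφ _
  | K a ih => exact hφ.elim

theorem evalT_MSigma (T : Set LFormula) (s : ℕ → ℕ) (t : LTerm) :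
    (MSigma T).evalT s t = StdModel.evalT s t := by
  induction t with
  | var n => rfl
  | zero => rfl
  | succ t ih => exact congrArg Nat.succ ih
  | add t u iht ihu => exact congrArg₂ (fun a b : ℕ => a + b) iht ihu
  | mul t u iht ihu => exact congrArg₂ (fun a b : ℕ => a * b) iht ihu

/-- `M_Σ` and the standard structure agree on `K`-free formulas. -/
theorem sat_MSigma_iff_of_kFree (T : Set LFormula) (φ : LFormula) (hφ : KFree φ) :
    ∀ s : ℕ → ℕ, (MSigma T).Sat s φ ↔ StdModel.Sat s φ := by
  induction φ with
  | eq t u =>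
    intro s
    have ht := evalT_MSigma T s t
    have hu := evalT_MSigma T s u
    exact ⟨fun h => ht.symm.trans (h.trans hu), fun h => ht.trans (h.trans hu.symm)⟩
  | falsum => intro s; rfl
  | imp a b iha ihb => intro s; exact imp_congr (iha hφ.1 s) (ihb hφ.2 s)
  | all y a ih => intro s; exact forall_congr' fun u : ℕ => ih hφ (Function.update s y u)
  | K a ih => exact hφ.elim

theorem evalT_StdModel_numeral (s : ℕ → ℕ) (n : ℕ) : StdModel.evalT s (numeral n) = n := by
  induction n with
  | zero => rfl
  | succ n ih => exact congrArg Nat.succ ih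

theorem StdModel_sat_instNum {φ : LFormula} (hφ : KFree φ) (r s : ℕ → ℕ) :
    StdModel.Sat s (instNum r φ) ↔ StdModel.Sat r φ := by
  have h := StdModel.sat_subst_of_kFree φ hφ (σ := fun z => numeral (r z))
    (fun z => .inr (numeral_fv _)) s
  have e : (fun z => StdModel.evalT s (numeral (r z))) = r :=
    funext fun z => evalT_StdModel_numeral s (r z)
  exact h.trans (by rw [e])

theorem StdModel_sat_subst1_numeral {φ : LFormula} (hφ : KFree φ) (x k : ℕ) (s : ℕ → ℕ) :
    StdModel.Sat s (subst1 x (numeral k) φ) ↔ StdModel.Sat (Function.update s x k) φ := by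
  have h := StdModel.sat_subst_of_kFree φ hφ (σ := fun z => if z = x then numeral k else .var z)
    (fun z => by split_ifs <;> simp [numeral_fv]) s
  have e : (fun z => StdModel.evalT s (if z = x then numeral k else .var z)) =
      Function.update s x k := by
    funext z
    by_cases hz : z = x
    · subst hz; simpa using evalT_StdModel_numeral s k
    · simp only [hz, if_false, LStructure.evalT]
      exact (Function.update_of_ne hz k s).symm
  exact h.trans (iff_of_eq (congrArg (StdModel.Sat · φ) e))

/-- In `M_Σ` the formula `pw(x, b̄, k̄)` expresses the truth of `pw(ā, b̄, k̄)`, where `a` is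
the value of `x`. -/
theorem sat_MSigma_subst1_iff_pwNum {pw : LFormula} (hfv : pw.fv ⊆ {vx, vy, ve})
    (hkf : KFree pw) (T : Set LFormula) (b k : ℕ) (s : ℕ → ℕ) :
    (MSigma T).Sat s (subst1 ve (numeral k) (subst1 vy (numeral b) pw)) ↔
      StdModel.Models (pwNum pw (s vx) b k) := by
  have hy : KFree (subst1 vy (numeral b) pw) := hkf.subst _
  refine (sat_MSigma_iff_of_kFree T _ (hy.subst _) s).trans ?_
  refine (StdModel_sat_subst1_numeral hy ve k s).trans ?_
  refine (StdModel_sat_subst1_numeral hkf vy b _).trans ?_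
  have key : StdModel.Sat (Function.update (Function.update s ve k) vy b) pw ↔
      StdModel.Sat (fun z => if z = vx then s vx else if z = vy then b else k) pw := by
    refine StdModel.sat_congr_of_kFree pw hkf fun z hz => ?_
    have hz' := hfv hz
    simp only [Finset.mem_insert, Finset.mem_singleton] at hz'
    rcases hz' with rfl | rfl | rfl <;> rfl
  exact key.trans ⟨fun h t => (StdModel_sat_instNum hkf _ t).2 h,
    fun h => (StdModel_sat_instNum hkf _ s).1 (h s)⟩

theorem pair_gnum_mem_goalSet {pw φ : LFormula} (hφ : φ.fv ⊆ {vx}) (n m : ℕ) :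
    Nat.pair m φ.gnum ∈ goalSet pw n ↔
      Consequence (SigmaN pw n) (subst1 vx (numeral m) φ) := by
  constructor
  · rintro ⟨m', ψ, h, -, hψ⟩
    obtain ⟨rfl, hg⟩ := Nat.pair_eq_pair.1 h
    obtain rfl := LFormula.gnum_injective hg
    exact hψ
  · exact fun h => ⟨m, φ, rfl, hφ, h⟩

theorem sat_iffF (M : LStructure) (s : ℕ → M.U) (φ ψ : LFormula) :
    M.Sat s (iffF φ ψ) ↔ (M.Sat s φ ↔ M.Sat s ψ) := by
  simp only [iffF, andF, notF, LStructure.Sat]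
  tauto

/-- Let n satisfy W_n = { ⟨m, ⌜φ⌝⟩ : φ with free variables ⊆ {x} and
Σ(n) ⊨ φ(x|m̄) }.  Then for every 𝓛-formula φ with free variables ⊆ {x}, the
structure M_(Σ(n)) satisfies ∀x (K φ ↔ ⟨x, ⌜φ⌝⟩ ∈ W_n̄). -/
theorem MSigmaN_satisfies_line3 (pw : LFormula) (hfv : pw.fv ⊆ {vx, vy, ve}) (hkf : KFree pw)
    (hcorr : ∀ a b k : ℕ, StdModel.Models (pwNum pw a b k) ↔ Nat.pair a b ∈ W k)
    (n : ℕ) (hW : W n = goalSet pw n) :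
    ∀ φ : LFormula, φ.fv ⊆ {vx} → (MSigma (SigmaN pw n)).Models (line3 pw n φ) := by
  intro φ hφ s (u : ℕ)
  let s' : ℕ → ℕ := Function.update s vx u
  refine (sat_iffF _ _ _ _).2 ?_
  refine Iff.trans ?_ (sat_MSigma_subst1_iff_pwNum hfv hkf _ _ _ s').symm
  rw [hcorr, hW, pair_gnum_mem_goalSet hφ, ← instNum_eq_subst1 hφ]
  exact Iff.rfl
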